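/- If θ_NE(1−p) > 0, then θ_NE(p) = 0. In particular, for no p can the NE-quadrant model percolate for both parameters p and 1−p. -/

import Mathlib

open MeasureTheory ENNReal

namespace RandomOrientation

/-- One step of the base-`(p, 1-p)` expansion map on `[0,1)`. -/
noncomputable def expand (p x : ℝ) : ℝ := if x < p then x / p else (x - p) / (1 - p)

/-- The `n`-th digit of the Bernoulli(`p`) expansion of `x`: for `x` uniformly
distributed on `[0,1)` the digits are i.i.d. `{true, false}`-valued with
`P(true) = p`. -/
noncomputable def bernDigit (p : ℝ) (n : ℕ) (x : ℝ) : Bool :=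
  decide ((expand p)^[n] x < p)

/-- The product over the countable index set `I` of Bernoulli(`p`) measures on
`Bool` (`P(true) = p`), realized as the joint distribution of the digits of the
Bernoulli(`p`) expansion of a uniform random point of `[0,1)`. -/
noncomputable def bernoulliProduct (I : Type*) [Encodable I] (p : ℝ) :
    Measure (I → Bool) :=
  Measure.map (fun x i => bernDigit p (Encodable.encode i) x)
    (volume.restrict (Set.Ico (0 : ℝ) 1))

/-- Edges of `ℤ²`: `(v, false)` is the horizontal edge from `v` to `v + (1,0)`,
`(v, true)` the vertical edge from `v` to `v + (0,1)`. -/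
abbrev Edge : Type := (ℤ × ℤ) × Bool

/-- An orientation configuration of the edges of `ℤ²`. -/
abbrev Config : Type := Edge → Bool

def eSrc (e : Edge) : ℤ × ℤ := e.1

def eDst (e : Edge) : ℤ × ℤ := if e.2 then (e.1.1, e.1.2 + 1) else (e.1.1 + 1, e.1.2)

/-- The law of the random orientation with parameter `p`: each edge independently
carries the bit `true` with probability `p`. -/
noncomputable def mu (p : ℝ) : Measure Config := bernoulliProduct Edge p

/-- The directed-edge relation of Grimmett's random-orientation model:
`ω e = true` means the edge `e` is oriented in the positive coordinate direction
(rightwards resp. upwards), `ω e = false` in the negative one. -/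
def gStep (ω : Config) (u v : ℤ × ℤ) : Prop :=
  ∃ e : Edge, (eSrc e = u ∧ eDst e = v ∧ ω e = true) ∨ (eSrc e = v ∧ eDst e = u ∧ ω e = false)

/-- Squared euclidean norm on `ℤ²`. -/
def normSq (v : ℤ × ℤ) : ℤ := v.1 ^ 2 + v.2 ^ 2

/-- The directed-edge relation of the H-model: `ω e = true` means the edge `e` is
oriented away from the origin, i.e. towards its endpoint of larger euclidean norm
(adjacent vertices of `ℤ²` never have equal norms). -/
def hStep (ω : Config) (u v : ℤ × ℤ) : Prop :=
  ∃ e : Edge, ((eSrc e = u ∧ eDst e = v) ∨ (eSrc e = v ∧ eDst e = u)) ∧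
    ω e = decide (normSq u < normSq v)

/-- There is an infinite directed self-avoiding path starting at the origin,
all of whose vertices lie in `S`, for the directed-step relation `R`. -/
def percolates (R : ℤ × ℤ → ℤ × ℤ → Prop) (S : Set (ℤ × ℤ)) : Prop :=
  ∃ γ : ℕ → ℤ × ℤ, γ 0 = (0, 0) ∧ Function.Injective γ ∧
    (∀ n, R (γ n) (γ (n + 1))) ∧ ∀ n, γ n ∈ S

/-- The (closed) North-East quadrant of `ℤ²`. -/
def NEquad : Set (ℤ × ℤ) := {v | 0 ≤ v.1 ∧ 0 ≤ v.2}

/-- `θ_H(p)`: percolation probability of the H-model with parameter `p`. -/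
noncomputable def thetaH (p : ℝ) : ℝ≥0∞ := mu p {ω | percolates (hStep ω) Set.univ}

/-- `θ_NE(p)`: probability of an infinite directed self-avoiding path from the
origin staying in the North-East quadrant, in the random-orientation model. -/
noncomputable def thetaNE (p : ℝ) : ℝ≥0∞ := mu p {ω | percolates (gStep ω) NEquad}

/-- `θ_G(p)`: percolation probability of Grimmett's random-orientation model. -/
noncomputable def thetaG (p : ℝ) : ℝ≥0∞ := mu p {ω | percolates (gStep ω) Set.univ}


open Relation

theorem gStep_iff (ω : Config) (u v : ℤ × ℤ) :
    gStep ω u v ↔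
      (v = (u.1 + 1, u.2) ∧ ω (u, false) = true) ∨ (v = (u.1, u.2 + 1) ∧ ω (u, true) = true) ∨
      (u = (v.1 + 1, v.2) ∧ ω (v, false) = false) ∨
      (u = (v.1, v.2 + 1) ∧ ω (v, true) = false) := by
  constructor
  · rintro ⟨⟨w, b⟩, ⟨h1, h2, h3⟩ | ⟨h1, h2, h3⟩⟩ <;> cases b <;>
      simp only [eSrc, eDst] at h1 h2 <;> subst h1 <;> simp_all
  · rintro (⟨h1, h2⟩ | ⟨h1, h2⟩ | ⟨h1, h2⟩ | ⟨h1, h2⟩)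
    · exact ⟨(u, false), Or.inl ⟨rfl, by simp [eDst, h1], h2⟩⟩
    · exact ⟨(u, true), Or.inl ⟨rfl, by simp [eDst, h1], h2⟩⟩
    · exact ⟨(v, false), Or.inr ⟨rfl, by simp [eDst, h1], h2⟩⟩
    · exact ⟨(v, true), Or.inr ⟨rfl, by simp [eDst, h1], h2⟩⟩

/-- The dual orientation. The pair `d` stands for the face of `ℤ²` centred at `d + (1/2, 1/2)`,
and every dual edge is obtained from the primal edge it crosses by a counterclockwise rotation. -/
def dualStep (ω : Config) (d d' : ℤ × ℤ) : Prop :=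
  (d' = (d.1 + 1, d.2) ∧ ω ((d.1 + 1, d.2), true) = false) ∨
  (d = (d'.1 + 1, d'.2) ∧ ω ((d'.1 + 1, d'.2), true) = true) ∨
  (d' = (d.1, d.2 + 1) ∧ ω ((d.1, d.2 + 1), false) = true) ∨
  (d = (d'.1, d'.2 + 1) ∧ ω ((d'.1, d'.2 + 1), false) = false)

/-- The union of the South-East and North-West quadrants with apex `c`. -/
def antiQuads (c : ℤ × ℤ) : Set (ℤ × ℤ) :=
  {d | (c.1 ≤ d.1 ∧ d.2 ≤ c.2) ∨ (d.1 ≤ c.1 ∧ c.2 ≤ d.2)}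

/-- A directed dual path in `antiQuads c` from `a` to `b` induces a height function on the vertices,
counting the signed crossings of the path with the upward vertical ray. It is monotone along
directed edges, up to a correction for the ends of the path. -/
theorem exists_height {ω : Config} {c a b : ℤ × ℤ}
    (hab : ReflTransGen (fun d d' => dualStep ω d d' ∧ d ∈ antiQuads c ∧ d' ∈ antiQuads c) a b) :
    ∃ f : ℤ → ℤ → ℤ,
      (∀ x y, ω ((x, y), true) = true → f x y ≤ f x (y + 1)) ∧
      (∀ x y, ω ((x, y), true) = false → f x (y + 1) ≤ f x y) ∧
      (∀ x y, ω ((x, y), false) = true →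
        f x y + (if a.1 = x ∧ y ≤ a.2 then 1 else 0) ≤
          f (x + 1) y + (if b.1 = x ∧ y ≤ b.2 then 1 else 0)) ∧
      (∀ x y, ω ((x, y), false) = false →
        f (x + 1) y + (if b.1 = x ∧ y ≤ b.2 then 1 else 0) ≤
          f x y + (if a.1 = x ∧ y ≤ a.2 then 1 else 0)) ∧
      (∀ x y, c.1 < x → c.2 < y → f x y = 0) ∧
      (∀ x y, x ≤ c.1 → y ≤ c.2 →
        f x y + (if x ≤ a.1 then 1 else 0) = if x ≤ b.1 then 1 else 0) := by
  induction hab with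
  | refl => exact ⟨fun _ _ => 0, by simp⟩
  | @tail d d' _ hstep ih =>
    obtain ⟨f, h1, h2, h3, h4, h5, h6⟩ := ih
    obtain ⟨d₁, d₂⟩ := d
    obtain ⟨e₁, e₂⟩ := d'
    obtain ⟨hstep, hd, he⟩ := hstep
    simp only [antiQuads, Set.mem_ofPred_eq] at hd he
    simp only [dualStep, Prod.mk.injEq] at hstep
    rcases hstep with ⟨⟨rfl, rfl⟩, hω⟩ | ⟨⟨rfl, rfl⟩, hω⟩ | ⟨⟨rfl, rfl⟩, hω⟩ | ⟨⟨rfl, rfl⟩, hω⟩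
    · refine ⟨fun x y => f x y + if x = d₁ + 1 ∧ y ≤ e₂ then 1 else 0,
        fun x y h => ?_, fun x y h => ?_, fun x y h => ?_, fun x y h => ?_,
        fun x y hx hy => ?_, fun x y hx hy => ?_⟩
      · have := h1 x y h
        clear h1 h2 h3 h4 h5 h6
        by_cases hxy : x = d₁ + 1 ∧ y = e₂
        · obtain ⟨rfl, rfl⟩ := hxy
          simp_all
        · grind
      · have := h2 x y h
        clear h1 h2 h3 h4 h5 h6
        grind
      · have := h3 x y h
        clear h1 h2 h3 h4 h5 h6
        grind
      · have := h4 x y h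
        clear h1 h2 h3 h4 h5 h6
        grind
      · have := h5 x y hx hy
        clear h1 h2 h3 h4 h5 h6
        grind
      · have := h6 x y hx hy
        clear h1 h2 h3 h4 h5 h6
        grind
    · refine ⟨fun x y => f x y - if x = e₁ + 1 ∧ y ≤ d₂ then 1 else 0,
        fun x y h => ?_, fun x y h => ?_, fun x y h => ?_, fun x y h => ?_,
        fun x y hx hy => ?_, fun x y hx hy => ?_⟩
      · have := h1 x y h
        clear h1 h2 h3 h4 h5 h6
        grind
      · have := h2 x y h
        clear h1 h2 h3 h4 h5 h6
        by_cases hxy : x = e₁ + 1 ∧ y = d₂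
        · obtain ⟨rfl, rfl⟩ := hxy
          simp_all
        · grind
      · have := h3 x y h
        clear h1 h2 h3 h4 h5 h6
        grind
      · have := h4 x y h
        clear h1 h2 h3 h4 h5 h6
        grind
      · have := h5 x y hx hy
        clear h1 h2 h3 h4 h5 h6
        grind
      · have := h6 x y hx hy
        clear h1 h2 h3 h4 h5 h6
        grind
    · refine ⟨f, h1, h2, fun x y h => ?_, fun x y h => ?_, h5, h6⟩
      · have := h3 x y h
        clear h1 h2 h3 h4 h5 h6
        grind
      · have := h4 x y h
        clear h1 h2 h3 h4 h5 h6
        by_cases hxy : x = e₁ ∧ y = d₂ + 1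
        · obtain ⟨rfl, rfl⟩ := hxy
          simp_all
        · grind
    · refine ⟨f, h1, h2, fun x y h => ?_, fun x y h => ?_, h5, h6⟩
      · have := h3 x y h
        clear h1 h2 h3 h4 h5 h6
        by_cases hxy : x = d₁ ∧ y = e₂ + 1
        · obtain ⟨rfl, rfl⟩ := hxy
          simp_all
        · grind
      · have := h4 x y h
        clear h1 h2 h3 h4 h5 h6
        grind

theorem exists_bound_of_reflTransGen_gStep {ω : Config} {s t : ℤ × ℤ}
    (h : ReflTransGen (gStep ω) s t) :
    ∃ M : ℤ, (-M ≤ t.1 ∧ t.1 ≤ M) ∧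
      ReflTransGen (fun u v => gStep ω u v ∧ (-M ≤ u.1 ∧ u.1 ≤ M) ∧ (-M ≤ v.1 ∧ v.1 ≤ M)) s t := by
  induction h with
  | refl => exact ⟨|s.1|, ⟨neg_abs_le _, le_abs_self _⟩, .refl⟩
  | @tail u v _ huv ih =>
    obtain ⟨M, hu, hM⟩ := ih
    have h1 := neg_abs_le v.1
    have h2 := le_abs_self v.1
    have h3 := abs_nonneg v.1
    refine ⟨max M |v.1|, by grind,
      .tail (ReflTransGen.mono (fun x y ⟨h, hx, hy⟩ => ⟨h, ?_, ?_⟩) _ _ hM) ⟨huv, ?_, ?_⟩⟩ <;> grind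

/-- A directed path from the North-East to the South-West quadrant of `c` cannot cross a
directed dual path going from far East to far West in the other two quadrants. -/
theorem not_reflTransGen_of_dual {ω : Config} {c s t : ℤ × ℤ}
    (ha : ∀ M : ℤ, ∃ a, M ≤ a.1 ∧
      ReflTransGen (fun d d' => dualStep ω d d' ∧ d ∈ antiQuads c ∧ d' ∈ antiQuads c) a c)
    (hb : ∀ M : ℤ, ∃ b, b.1 ≤ -M ∧
      ReflTransGen (fun d d' => dualStep ω d d' ∧ d ∈ antiQuads c ∧ d' ∈ antiQuads c) c b)
    (hs : c.1 < s.1 ∧ c.2 < s.2) (ht : t.1 ≤ c.1 ∧ t.2 ≤ c.2) :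
    ¬ ReflTransGen (gStep ω) s t := by
  intro hst
  obtain ⟨M, htM, hM⟩ := exists_bound_of_reflTransGen_gStep hst
  obtain ⟨a, haM, hac⟩ := ha (M + 1)
  obtain ⟨b, hbM, hcb⟩ := hb (M + 1)
  obtain ⟨f, h1, h2, h3, h4, h5, h6⟩ := exists_height (hac.trans hcb)
  have key : f s.1 s.2 ≤ f t.1 t.2 := by
    clear hst h5 h6 hs ht htM
    induction hM with
    | refl => exact le_rfl
    | @tail u v _ huv ih =>
      refine ih.trans ?_
      obtain ⟨huv, hu, hv⟩ := huv
      obtain ⟨u₁, u₂⟩ := u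
      obtain ⟨v₁, v₂⟩ := v
      rw [gStep_iff] at huv
      simp only [Prod.mk.injEq] at huv
      rcases huv with ⟨⟨rfl, rfl⟩, hω⟩ | ⟨⟨rfl, rfl⟩, hω⟩ | ⟨⟨rfl, rfl⟩, hω⟩ | ⟨⟨rfl, rfl⟩, hω⟩
      · have := h3 _ _ hω
        grind
      · exact h1 _ _ hω
      · have := h4 _ _ hω
        grind
      · exact h2 _ _ hω
  have h5' := h5 _ _ hs.1 hs.2
  have h6' := h6 _ _ ht.1 ht.2
  rw [if_pos (by omega), if_neg (by omega)] at h6'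
  omega

/-- The Bernoulli measure on `Bool` giving mass `p` to `true`. -/
noncomputable def coin (p : unitInterval) : Measure Bool :=
  ENNReal.ofReal p • Measure.dirac true + ENNReal.ofReal (1 - p) • Measure.dirac false

instance (p : unitInterval) : IsProbabilityMeasure (coin p) := by
  constructor
  have h1 := p.2.1
  have h2 := p.2.2
  simp only [coin, Measure.add_apply, Measure.smul_apply, measure_univ, smul_eq_mul, mul_one]
  rw [← ENNReal.ofReal_add h1 (by linarith)]
  simp

theorem map_not_coin (p : unitInterval) :
    (coin p).map (fun b => !b) = coin (unitInterval.symm p) := by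
  have h : Measurable fun b : Bool => !b := by fun_prop
  rw [coin, Measure.map_add _ _ h, Measure.map_smul, Measure.map_smul, Measure.map_dirac' h,
    Measure.map_dirac' h, coin, add_comm]
  simp

open Classical in
theorem coin_apply (p : unitInterval) (t : Set Bool) :
    coin p t = (if true ∈ t then ENNReal.ofReal p else 0) +
      (if false ∈ t then ENNReal.ofReal (1 - p) else 0) := by
  simp only [coin, Measure.add_apply, Measure.smul_apply, smul_eq_mul,
    Measure.dirac_apply, Set.indicator_apply, Pi.one_apply, mul_ite, mul_one, mul_zero]

theorem measurable_expand (p : ℝ) : Measurable (expand p) := by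
  unfold expand
  exact Measurable.ite measurableSet_Iio (by fun_prop) (by fun_prop)

theorem measurable_bernDigit (p : ℝ) (n : ℕ) : Measurable (bernDigit p n) := by
  refine measurable_to_bool ?_
  have : bernDigit p n ⁻¹' {true} = (expand p)^[n] ⁻¹' Set.Iio p := by
    ext x
    simp [bernDigit]
  rw [this]
  exact ((measurable_expand p).iterate n) measurableSet_Iio

theorem volume_div_mem (p : unitInterval) (S : Set ℝ) :
    volume {x : ℝ | 0 ≤ x ∧ x < p ∧ x / p ∈ S} =
      ENNReal.ofReal p * volume (Set.Ico 0 1 ∩ S) := by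
  rcases p.2.1.eq_or_lt with h | h
  · rw [← h, ENNReal.ofReal_zero, zero_mul]
    convert measure_empty (μ := (volume : Measure ℝ))
    ext x
    simp only [Set.mem_ofPred_eq, Set.mem_empty_iff_false, iff_false]
    intro hx
    linarith [hx.1, hx.2.1]
  · have hset : {x : ℝ | 0 ≤ x ∧ x < p ∧ x / p ∈ S} =
        (fun x => (p : ℝ)⁻¹ * x) ⁻¹' (Set.Ico 0 1 ∩ S) := by
      ext x
      simp only [Set.mem_ofPred_eq, Set.mem_preimage, Set.mem_inter_iff, Set.mem_Ico,
        inv_mul_eq_div, div_lt_one h, and_assoc]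
      exact and_congr_left fun _ => ⟨fun hx => div_nonneg hx h.le,
        fun hx => by simpa [h.ne'] using mul_nonneg hx h.le⟩
    rw [hset, Real.volume_preimage_mul_left (inv_ne_zero h.ne'), inv_inv, abs_of_pos h]

theorem volume_sub_div_mem (p : unitInterval) (S : Set ℝ) :
    volume {x : ℝ | p ≤ x ∧ x < 1 ∧ (x - p) / (1 - p) ∈ S} =
      ENNReal.ofReal (1 - p) * volume (Set.Ico 0 1 ∩ S) := by
  rw [← unitInterval.coe_symm_eq, ← volume_div_mem, unitInterval.coe_symm_eq,
    ← measure_preimage_add_right _ (-(p : ℝ)) {x : ℝ | 0 ≤ x ∧ _}]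
  congr 1
  ext x
  simp only [Set.mem_ofPred_eq, Set.mem_preimage, ← sub_eq_add_neg, sub_nonneg,
    sub_lt_sub_iff_right]

theorem volume_bernDigit_expand (p : unitInterval) (t : Set Bool) (S : Set ℝ) :
    volume (Set.Ico 0 1 ∩ {x | decide (x < (p : ℝ)) ∈ t ∧ expand p x ∈ S}) =
      coin p t * volume (Set.Ico 0 1 ∩ S) := by
  classical
  have h0 := p.2.1
  have h1 := p.2.2
  rw [← measure_inter_add_sdiff _ (measurableSet_Iio (a := (p : ℝ))), coin_apply, add_mul]
  congr 1
  · split_ifs with ht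
    · rw [← volume_div_mem]
      congr 1
      ext x
      simp only [expand, Set.mem_inter_iff, Set.mem_Ico, Set.mem_ofPred_eq, Set.mem_Iio]
      constructor
      · rintro ⟨⟨hx, -, h⟩, hxp⟩
        rw [if_pos hxp] at h
        exact ⟨hx.1, hxp, h⟩
      · rintro ⟨hx, hxp, h⟩
        rw [if_pos hxp]
        exact ⟨⟨⟨hx, hxp.trans_le h1⟩, by simpa [hxp] using ht, h⟩, hxp⟩
    · rw [zero_mul]
      convert measure_empty (μ := (volume : Measure ℝ))
      ext x
      simp only [Set.mem_inter_iff, Set.mem_ofPred_eq, Set.mem_Iio, Set.mem_empty_iff_false,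
        iff_false]
      rintro ⟨⟨-, h, -⟩, hxp⟩
      simp [hxp, ht] at h
  · split_ifs with ht
    · rw [← volume_sub_div_mem]
      congr 1
      ext x
      simp only [expand, Set.mem_inter_iff, Set.mem_Ico, Set.mem_ofPred_eq, Set.mem_Iio,
        Set.mem_sdiff, not_lt]
      constructor
      · rintro ⟨⟨hx, -, h⟩, hxp⟩
        rw [if_neg hxp.not_gt] at h
        exact ⟨hxp, hx.2, h⟩
      · rintro ⟨hxp, hx, h⟩
        rw [if_neg hxp.not_gt]
        exact ⟨⟨⟨h0.trans hxp, hx⟩, by simpa [hxp.not_gt] using ht, h⟩, hxp⟩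
    · rw [zero_mul]
      convert measure_empty (μ := (volume : Measure ℝ))
      ext x
      simp only [Set.mem_inter_iff, Set.mem_ofPred_eq, Set.mem_Iio, Set.mem_empty_iff_false,
        iff_false, Set.mem_sdiff, not_lt]
      rintro ⟨⟨-, h, -⟩, hxp⟩
      simp [hxp.not_gt, ht] at h

theorem volume_forall_bernDigit_mem (p : unitInterval) (N : ℕ) (t : ℕ → Set Bool) :
    volume (Set.Ico 0 1 ∩ {x | ∀ n < N, bernDigit p n x ∈ t n}) =
      ∏ n ∈ Finset.range N, coin p (t n) := by
  induction N generalizing t with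
  | zero => simp
  | succ N ih =>
    rw [Finset.prod_range_succ', ← ih fun n => t (n + 1), mul_comm, ← volume_bernDigit_expand]
    congr 2
    ext x
    simp only [Set.mem_ofPred_eq]
    constructor
    · exact fun h => ⟨h 0 N.succ_pos, fun n hn => h (n + 1) (Nat.succ_lt_succ hn)⟩
    · rintro ⟨h, h'⟩ (_ | n) hn
      · exact h
      · exact h' n (Nat.lt_of_succ_lt_succ hn)

theorem bernoulliProduct_eq_infinitePi (I : Type*) [Encodable I] (p : unitInterval) :
    bernoulliProduct I p = Measure.infinitePi fun _ : I => coin p := by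
  classical
  refine Measure.eq_infinitePi _ fun s t ht => ?_
  have hmeas : Measurable fun (x : ℝ) (i : I) => bernDigit p (Encodable.encode i) x :=
    measurable_pi_lambda _ fun i => measurable_bernDigit p _
  have hpi : MeasurableSet (Set.pi (s : Set I) t) :=
    MeasurableSet.pi s.countable_toSet fun i _ => ht i
  rw [bernoulliProduct, Measure.map_apply hmeas hpi, Measure.restrict_apply (hmeas hpi),
    Set.inter_comm]
  set N := s.sup Encodable.encode + 1
  have hN : ∀ i ∈ s, Encodable.encode i < N := fun i hi =>
    Nat.lt_succ_of_le (Finset.le_sup (f := Encodable.encode) hi)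
  let t' : ℕ → Set Bool := fun n => {b | ∀ i ∈ s, Encodable.encode i = n → b ∈ t i}
  have ht' : ∀ i ∈ s, t' (Encodable.encode i) = t i := by
    intro i hi
    ext b
    refine ⟨fun h => h i hi rfl, fun h j _ hij => ?_⟩
    rwa [Encodable.encode_injective hij]
  have hset : (fun (x : ℝ) (i : I) => bernDigit p (Encodable.encode i) x) ⁻¹' Set.pi (s : Set I) t =
      {x | ∀ n < N, bernDigit p n x ∈ t' n} := by
    ext x
    simp only [Set.mem_preimage, Set.mem_pi, Set.mem_ofPred_eq, Finset.mem_coe, t']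
    constructor
    · rintro h n - i hi rfl
      exact h i hi
    · exact fun h i hi => h _ (hN i hi) i hi rfl
  have hprod : ∏ i ∈ s, coin p (t i) = ∏ i ∈ s, coin p (t' (Encodable.encode i)) :=
    Finset.prod_congr rfl fun i hi => by rw [ht' i hi]
  rw [hset, volume_forall_bernDigit_mem, hprod,
    ← Finset.prod_image (f := fun n => coin p (t' n)) Encodable.encode_injective.injOn]
  refine (Finset.prod_subset ?_ fun n _ hn => ?_).symm
  · intro n hn
    obtain ⟨i, hi, rfl⟩ := Finset.mem_image.1 hn
    exact Finset.mem_range.2 (hN i hi)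
  · have : t' n = Set.univ := by
      refine Set.eq_univ_of_forall fun b i hi hin => ?_
      exact absurd (Finset.mem_image.2 ⟨i, hi, hin⟩) hn
    rw [this, measure_univ]

open ProbabilityTheory in
theorem infinitePi_inter_of_dependsOn {ι : Type*} {X : ι → Type*} [∀ i, MeasurableSpace (X i)]
    [∀ i, Nonempty (X i)] (P : ∀ i, Measure (X i)) [∀ i, IsProbabilityMeasure (P i)]
    {A B : Set (∀ i, X i)} (hA : MeasurableSet A) (hB : MeasurableSet B) {S T : Set ι}
    (hST : Disjoint S T) (hAS : DependsOn (· ∈ A) S) (hBT : DependsOn (· ∈ B) T) :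
    Measure.infinitePi P (A ∩ B) = Measure.infinitePi P A * Measure.infinitePi P B := by
  classical
  have key : ∀ {A : Set (∀ i, X i)} {S : Set ι}, MeasurableSet A → DependsOn (· ∈ A) S →
      MeasurableSet[⨆ i ∈ S, MeasurableSpace.comap (fun ω : ∀ i, X i => ω i) inferInstance] A := by
    intro A S hA hAS
    let r : (∀ i, X i) → ∀ i, X i := fun ω i => if i ∈ S then ω i else Classical.arbitrary _
    have hr :
        Measurable[⨆ i ∈ S, MeasurableSpace.comap (fun ω : ∀ i, X i => ω i) inferInstance] r := by
      refine @measurable_pi_lambda _ _ _ (_) _ _ fun i => ?_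
      by_cases hi : i ∈ S
      · simp only [r, if_pos hi]
        refine Measurable.mono (comap_measurable fun ω : ∀ i, X i => ω i) ?_ le_rfl
        exact le_iSup₂ (f := fun i (_ : i ∈ S) =>
          MeasurableSpace.comap (fun ω : ∀ i, X i => ω i) inferInstance) i hi
      · simp only [r, if_neg hi]
        exact measurable_const
    have : r ⁻¹' A = A := by
      ext ω
      exact iff_of_eq (hAS fun i hi => by simp [r, hi])
    rw [← this]
    exact hr hA
  have hind := iIndepFun_infinitePi (P := P) (X := fun _ ω => ω) fun i => measurable_id
  exact (Indep_iff _ _ _).1 (indep_iSup_of_disjoint (fun i => (measurable_pi_apply i).comap_le)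
    hind.iIndep hST) A B (key hA hAS) (key hB hBT)

theorem exists_cylinder_of_isClosed {ι : Type*} [Countable ι] (ν : Measure (ι → Bool))
    [IsFiniteMeasure ν] {K : Set (ι → Bool)} (hK : IsClosed K) {ε : ℝ≥0∞} (hε : ε ≠ 0) :
    ∃ (F : Finset ι) (C : Set (ι → Bool)), MeasurableSet C ∧ DependsOn (· ∈ C) F ∧ K ⊆ C ∧
      ν (C \ K) < ε := by
  let C : Finset ι → Set (ι → Bool) := fun F => {ω | ∃ ω' ∈ K, ∀ i ∈ F, ω i = ω' i}
  have hdep : ∀ F, DependsOn (· ∈ C F) (F : Set ι) := by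
    intro F ω₁ ω₂ h
    refine propext (exists_congr fun ω' => and_congr_right fun _ => ?_)
    exact forall₂_congr fun i hi => by rw [h i hi]
  have hmeas : ∀ F, MeasurableSet (C F) := by
    intro F
    have : C F = F.restrict ⁻¹' (F.restrict '' K) := by
      ext ω
      simp only [C, Set.mem_ofPred_eq, Set.mem_preimage, Set.mem_image, funext_iff, Subtype.forall,
        Finset.restrict, eq_comm]
    rw [this]
    exact (Finset.measurable_restrict (X := fun _ => Bool) F) (Set.toFinite _).measurableSet
  have hsub : ∀ F, K ⊆ C F := fun F ω hω => ⟨ω, hω, fun _ _ => rfl⟩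
  have hanti : Antitone C := fun F G hFG ω ⟨ω', h, h'⟩ => ⟨ω', h, fun i hi => h' i (hFG hi)⟩
  have hinter : ⋂ F, C F = K := by
    refine Set.Subset.antisymm (fun ω hω => ?_) (Set.subset_iInter hsub)
    rw [← hK.closure_eq, mem_closure_iff_nhds]
    intro U hU
    rw [nhds_pi, Filter.mem_pi] at hU
    obtain ⟨I, hI, t, ht, htU⟩ := hU
    obtain ⟨ω', h, h'⟩ := Set.mem_iInter.1 hω hI.toFinset
    refine ⟨ω', htU fun i hi => ?_, h⟩
    rw [← h' i (hI.mem_toFinset.2 hi)]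
    exact mem_of_mem_nhds (ht i)
  have hlim := tendsto_measure_iInter_atTop (μ := ν) (fun F => (hmeas F).nullMeasurableSet) hanti
    ⟨∅, measure_ne_top _ _⟩
  rw [hinter] at hlim
  have hlt : ν K < ν K + ε := ENNReal.lt_add_right (measure_ne_top _ _) hε
  obtain ⟨F, hF⟩ := ((tendsto_order.1 hlim).2 _ hlt).exists
  refine ⟨F, C F, hmeas F, hdep F, hsub F, ?_⟩
  rw [measure_sdiff (hsub F) hK.measurableSet.nullMeasurableSet (measure_ne_top _ _)]
  exact ENNReal.sub_lt_of_lt_add (measure_mono (hsub F)) (by rwa [add_comm])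

/-- Qualitative mixing of Bernoulli product measures under reindexings that eventually move any
finite set of indices off itself. -/
theorem exists_measure_inter_preimage_ne_zero {ι κ : Type*} [Countable ι] (P : Measure Bool)
    [IsProbabilityMeasure P] {τ : κ → ι → ι} (hτ : ∀ k, Function.Injective (τ k))
    (hdisj : ∀ F : Finset ι, ∃ k, ∀ i ∈ F, τ k i ∉ F) {A B : Set (ι → Bool)}
    (hA : MeasurableSet A) (hB : MeasurableSet B)
    (hA0 : Measure.infinitePi (fun _ : ι => P) A ≠ 0)
    (hB0 : Measure.infinitePi (fun _ : ι => P) B ≠ 0) :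
    ∃ k, Measure.infinitePi (fun _ : ι => P) (A ∩ {ω | (fun i => ω (τ k i)) ∈ B}) ≠ 0 := by
  classical
  set ν := Measure.infinitePi (fun _ : ι => P)
  obtain ⟨K, hKA, hK, hK0⟩ :=
    hA.exists_lt_isClosed_of_ne_top (measure_ne_top ν _) (pos_iff_ne_zero.2 hA0)
  obtain ⟨L, hLB, hL, hL0⟩ :=
    hB.exists_lt_isClosed_of_ne_top (measure_ne_top ν _) (pos_iff_ne_zero.2 hB0)
  have hpos : ν K * ν L ≠ 0 := mul_ne_zero hK0.ne' hL0.ne'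
  have hε : ν K * ν L / 2 ≠ 0 := (ENNReal.half_pos hpos).ne'
  obtain ⟨F, C, hC, hCF, hKC, hCK⟩ := exists_cylinder_of_isClosed ν hK hε
  obtain ⟨G, D, hD, hDG, hLD, hDL⟩ := exists_cylinder_of_isClosed ν hL hε
  obtain ⟨k, hk⟩ := hdisj (F ∪ G)
  let T : (ι → Bool) → ι → Bool := fun ω i => ω (τ k i)
  have hT : MeasurePreserving T ν ν :=
    ⟨by fun_prop, Measure.map_infinitePi_infinitePi_of_inj (P := fun _ => P) (hτ k)⟩
  refine ⟨k, fun hzero => ?_⟩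
  have hind : ν (C ∩ T ⁻¹' D) = ν C * ν D := by
    rw [infinitePi_inter_of_dependsOn (fun _ => P) hC (hT.measurable hD) (S := F)
      (T := τ k '' G) ?_ hCF ?_, hT.measure_preimage hD.nullMeasurableSet]
    · rw [Set.disjoint_left]
      rintro _ hF ⟨i, hi, rfl⟩
      exact hk i (Finset.mem_union_right _ hi) (Finset.mem_union_left _ hF)
    · intro ω₁ ω₂ h
      exact hDG fun i hi => h _ ⟨i, hi, rfl⟩
  have hsub : C ∩ T ⁻¹' D ⊆ (A ∩ T ⁻¹' B) ∪ ((C \ K) ∪ T ⁻¹' (D \ L)) := by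
    rintro ω ⟨hωC, hωD⟩
    by_cases h1 : ω ∈ K
    · by_cases h2 : T ω ∈ L
      · exact Or.inl ⟨hKA h1, hLB h2⟩
      · exact Or.inr (Or.inr ⟨hωD, h2⟩)
    · exact Or.inr (Or.inl ⟨hωC, h1⟩)
  have hlt : ν K * ν L < ν K * ν L := calc
    ν K * ν L ≤ ν C * ν D := mul_le_mul' (measure_mono hKC) (measure_mono hLD)
    _ = ν (C ∩ T ⁻¹' D) := hind.symm
    _ ≤ ν (A ∩ T ⁻¹' B) + (ν (C \ K) + ν (T ⁻¹' (D \ L))) :=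
      (measure_mono hsub).trans ((measure_union_le _ _).trans
        (add_le_add_right (measure_union_le _ _) _))
    _ = ν (C \ K) + ν (D \ L) := by
      rw [hT.measure_preimage (hD.diff hL.measurableSet).nullMeasurableSet]
      change ν (A ∩ T ⁻¹' B) = 0 at hzero
      rw [hzero, zero_add]
    _ < ν K * ν L / 2 + ν K * ν L / 2 := ENNReal.add_lt_add hCK hDL
    _ = ν K * ν L := ENNReal.add_halves _
  exact hlt.false

/-- The directed-edge relation inside the North-East quadrant. -/
def quadStep (ω : Config) (u v : ℤ × ℤ) : Prop := gStep ω u v ∧ u ∈ NEquad ∧ v ∈ NEquad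

/-- The configurations in which the origin is connected, inside the North-East quadrant, to
vertices with arbitrarily large first coordinate. -/
def reachesEast : Set Config :=
  {ω | ∀ k : ℤ, ∃ v : ℤ × ℤ, k ≤ v.1 ∧ ReflTransGen (quadStep ω) (0, 0) v}

/-- The edges of the North-East quadrant. -/
def quadEdges : Set Edge := {e | 0 ≤ e.1.1 ∧ 0 ≤ e.1.2}

theorem mem_NEquad_of_reflTransGen {ω : Config} {v : ℤ × ℤ}
    (h : ReflTransGen (quadStep ω) (0, 0) v) : v ∈ NEquad := by
  cases h with
  | refl => exact ⟨le_rfl, le_rfl⟩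
  | tail _ h => exact h.2.2

theorem measurableSet_reachesEast : MeasurableSet reachesEast := by
  have hopen : ∀ v, IsOpen {ω : Config | ReflTransGen (quadStep ω) (0, 0) v} := by
    refine fun v => isOpen_iff_mem_nhds.2 fun ω hω => ?_
    change ∀ᶠ ω' in nhds ω, ReflTransGen (quadStep ω') (0, 0) v
    induction hω with
    | refl => exact Filter.Eventually.of_forall fun _ => .refl
    | tail _ h ih =>
      obtain ⟨⟨e, he⟩, hu, hv⟩ := h
      have hcont : ∀ᶠ ω' in nhds ω, ω' e = ω e :=
        (continuous_apply e).continuousAt.eventually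
          (show ∀ᶠ b in nhds (ω e), b = ω e by simp)
      filter_upwards [ih, hcont] with ω' h1 h2
      exact h1.tail ⟨⟨e, by rwa [h2]⟩, hu, hv⟩
  have : reachesEast = ⋂ k : ℤ, ⋃ v : ℤ × ℤ, ⋃ _ : k ≤ v.1,
      {ω : Config | ReflTransGen (quadStep ω) (0, 0) v} := by
    ext ω
    simp [reachesEast]
  rw [this]
  exact .iInter fun k => .iUnion fun v => .iUnion fun _ => (hopen v).measurableSet

theorem quadStep_congr {ω ω' : Config} (h : ∀ e ∈ quadEdges, ω e = ω' e) :
    quadStep ω = quadStep ω' := by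
  ext u v
  refine and_congr_left fun ⟨hu, hv⟩ => ?_
  have hu' := fun b => h (u, b) hu
  have hv' := fun b => h (v, b) hv
  simp only [gStep_iff, hu', hv']

theorem dependsOn_reachesEast : DependsOn (· ∈ reachesEast) quadEdges := by
  intro ω ω' h
  simp only [reachesEast, Set.mem_ofPred_eq, quadStep_congr h]

/-- The reflection of an edge in the diagonal. -/
def swapEdge (e : Edge) : Edge := ((e.1.2, e.1.1), !e.2)

/-- The image of an edge under `(x, y) ↦ (-y, -x)`. -/
def antiSwapEdge (e : Edge) : Edge :=
  if e.2 then ((-e.1.2 - 1, -e.1.1), false) else ((-e.1.2, -e.1.1 - 1), true)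

/-- The edge crossed by the dual edge corresponding to `e` under `(x, y) ↦ (-x, y)`. -/
def dualNW (e : Edge) : Edge :=
  if e.2 then ((-e.1.1, e.1.2 + 1), false) else ((-e.1.1, e.1.2), true)

/-- The edge crossed by the dual edge corresponding to `e` under `(x, y) ↦ (x, -y)`. -/
def dualSE (e : Edge) : Edge :=
  if e.2 then ((e.1.1, -e.1.2), false) else ((e.1.1 + 1, -e.1.2), true)

/-- The translate of an edge by `(k, -k - 1)`. -/
def shiftEdge (k : ℕ) (e : Edge) : Edge := ((e.1.1 + k, e.1.2 - k - 1), e.2)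

theorem swapEdge_injective : Function.Injective swapEdge := by
  rintro ⟨⟨a, b⟩, i⟩ ⟨⟨c, d⟩, j⟩ h
  cases i <;> cases j <;> simp_all [swapEdge]

theorem antiSwapEdge_injective : Function.Injective antiSwapEdge := by
  rintro ⟨⟨a, b⟩, i⟩ ⟨⟨c, d⟩, j⟩ h
  cases i <;> cases j <;> simp_all [antiSwapEdge]

theorem dualNW_injective : Function.Injective dualNW := by
  rintro ⟨⟨a, b⟩, i⟩ ⟨⟨c, d⟩, j⟩ h
  cases i <;> cases j <;> simp_all [dualNW]

theorem dualSE_injective : Function.Injective dualSE := by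
  rintro ⟨⟨a, b⟩, i⟩ ⟨⟨c, d⟩, j⟩ h
  cases i <;> cases j <;> simp_all [dualSE]

theorem shiftEdge_injective (k : ℕ) : Function.Injective (shiftEdge k) := by
  rintro ⟨⟨a, b⟩, i⟩ ⟨⟨c, d⟩, j⟩ h
  simp_all [shiftEdge]

theorem exists_shiftEdge_notMem (F : Finset Edge) : ∃ k, ∀ e ∈ F, shiftEdge k e ∉ F := by
  obtain ⟨M, hM⟩ : ∃ M : ℕ, ∀ e ∈ F, e.1.1.natAbs ≤ M :=
    ⟨F.sup fun e => e.1.1.natAbs, fun e he => Finset.le_sup (f := fun e : Edge => e.1.1.natAbs) he⟩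
  refine ⟨2 * M + 1, fun e he he' => ?_⟩
  have h1 := hM e he
  have h2 := hM _ he'
  simp only [shiftEdge] at h2
  omega

theorem percolates_NEquad_imp {ω : Config} (h : percolates (gStep ω) NEquad) :
    ω ∈ reachesEast ∨ (fun e => ω (swapEdge e)) ∈ reachesEast := by
  obtain ⟨γ, h0, hinj, hstep, hmem⟩ := h
  have hreach : ∀ n, ReflTransGen (quadStep ω) (0, 0) (γ n) := by
    intro n
    induction n with
    | zero => rw [h0]
    | succ n ih => exact ih.tail ⟨hstep n, hmem n, hmem (n + 1)⟩
  by_contra! hcon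
  obtain ⟨h1, h2⟩ := hcon
  simp only [reachesEast, Set.mem_ofPred_eq, not_forall, not_exists, not_and] at h1 h2
  obtain ⟨K, hK⟩ := h1
  obtain ⟨L, hL⟩ := h2
  have hswap : ∀ v, ReflTransGen (quadStep ω) (0, 0) v →
      ReflTransGen (quadStep fun e => ω (swapEdge e)) (0, 0) v.swap := by
    intro v hv
    refine ReflTransGen.lift Prod.swap ?_ (0, 0) v hv
    rintro ⟨a, b⟩ ⟨c, d⟩ ⟨h, hu, hv⟩
    refine ⟨?_, hu.symm, hv.symm⟩
    rw [gStep_iff] at h ⊢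
    simp only [Prod.mk.injEq, Prod.swap_prod_mk, swapEdge, Bool.not_false, Bool.not_true] at h ⊢
    tauto
  have hbdd : ∀ n, γ n ∈ Set.Icc (0 : ℤ) K ×ˢ Set.Icc (0 : ℤ) L := by
    intro n
    refine ⟨⟨(hmem n).1, ?_⟩, ⟨(hmem n).2, ?_⟩⟩
    · by_contra! hlt
      exact hK _ hlt.le (hreach n)
    · by_contra! hlt
      exact hL (γ n).swap hlt.le (hswap _ (hreach n))
  have hfin : (Set.range γ).Finite :=
    ((Set.finite_Icc _ _).prod (Set.finite_Icc _ _)).subset (Set.range_subset_iff.2 hbdd)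
  exact Set.infinite_range_of_injective hinj hfin

/-- The law of the configuration as an infinite product measure. -/
noncomputable abbrev law (p : unitInterval) : Measure Config :=
  Measure.infinitePi fun _ : Edge => coin p

theorem measurePreserving_reindex (p : unitInterval) {σ : Edge → Edge} (hσ : Function.Injective σ) :
    MeasurePreserving (fun (ω : Config) e => ω (σ e)) (law p) (law p) :=
  ⟨by fun_prop, Measure.map_infinitePi_infinitePi_of_inj (P := fun _ => coin p) hσ⟩

theorem measurePreserving_not (p : unitInterval) :
    MeasurePreserving (fun (ω : Config) e => !ω e) (law p) (law (unitInterval.symm p)) := by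
  refine ⟨by fun_prop, ?_⟩
  rw [Measure.infinitePi_map_pi (fun _ : Edge => coin p) (f := fun _ b => !b) fun _ => by fun_prop]
  simp only [map_not_coin]

theorem law_reachesEast_ne_zero (p : unitInterval) (h : thetaNE p ≠ 0) :
    law p reachesEast ≠ 0 := by
  intro h0
  refine h (measure_mono_null (fun ω hω => percolates_NEquad_imp hω) ?_)
  rw [mu, bernoulliProduct_eq_infinitePi]
  exact measure_union_null h0 (((measurePreserving_reindex p swapEdge_injective).measure_preimage
    measurableSet_reachesEast.nullMeasurableSet).trans h0)

theorem dependsOn_preimage_reachesEast (σ : Edge → Edge) (φ : Bool → Bool) :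
    DependsOn (· ∈ {ω : Config | (fun e => φ (ω (σ e))) ∈ reachesEast}) (σ '' quadEdges) :=
  fun _ _ h => dependsOn_reachesEast fun e he => congrArg φ (h _ ⟨e, he, rfl⟩)

/-- The configurations with an infinite dual path from the South-East through the face `(0, 0)`
to the North-West. -/
def dualCrossing : Set Config :=
  {ω | (fun e => ω (dualNW e)) ∈ reachesEast} ∩ {ω | (fun e => ω (dualSE e)) ∈ reachesEast}

/-- The configurations with an infinite path from the North-East through the origin
to the South-West. -/
def primalCrossing : Set Config :=
  {ω | (fun e => !ω e) ∈ reachesEast} ∩ {ω | (fun e => !ω (antiSwapEdge e)) ∈ reachesEast}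

theorem measurableSet_dualCrossing : MeasurableSet dualCrossing :=
  (measurableSet_preimage (by fun_prop) measurableSet_reachesEast).inter
    (measurableSet_preimage (by fun_prop) measurableSet_reachesEast)

theorem measurableSet_primalCrossing : MeasurableSet primalCrossing :=
  (measurableSet_preimage (by fun_prop) measurableSet_reachesEast).inter
    (measurableSet_preimage (by fun_prop) measurableSet_reachesEast)

theorem law_dualCrossing (p : unitInterval) :
    law p dualCrossing = law p reachesEast * law p reachesEast := by
  have h1 := measurePreserving_reindex p dualNW_injective
  have h2 := measurePreserving_reindex p dualSE_injective
  have hE := measurableSet_reachesEast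
  refine (infinitePi_inter_of_dependsOn (fun _ => coin p) (h1.measurable hE) (h2.measurable hE) ?_
    (dependsOn_preimage_reachesEast dualNW id) (dependsOn_preimage_reachesEast dualSE id)).trans ?_
  rotate_left
  · exact congrArg₂ _ (h1.measure_preimage hE.nullMeasurableSet)
      (h2.measure_preimage hE.nullMeasurableSet)
  · rw [Set.disjoint_left]
    rintro _ ⟨⟨⟨a, b⟩, i⟩, ⟨ha, hb⟩, rfl⟩ ⟨⟨⟨c, d⟩, j⟩, ⟨hc, hd⟩, h⟩
    simp only at ha hb hc hd
    cases i <;> cases j <;> simp [dualNW, dualSE] at h <;> omega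

theorem law_primalCrossing (p : unitInterval) :
    law p primalCrossing =
      law (unitInterval.symm p) reachesEast * law (unitInterval.symm p) reachesEast := by
  have h1 := measurePreserving_not p
  have h2 := (measurePreserving_not p).comp (measurePreserving_reindex p antiSwapEdge_injective)
  have hE := measurableSet_reachesEast
  refine (infinitePi_inter_of_dependsOn (fun _ => coin p) (h1.measurable hE) (h2.measurable hE) ?_
    (dependsOn_preimage_reachesEast id not)
    (dependsOn_preimage_reachesEast antiSwapEdge not)).trans ?_
  rotate_left
  · exact congrArg₂ _ (h1.measure_preimage hE.nullMeasurableSet)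
      (h2.measure_preimage hE.nullMeasurableSet)
  · rw [Set.disjoint_left]
    rintro _ ⟨⟨⟨a, b⟩, i⟩, ⟨ha, hb⟩, rfl⟩ ⟨⟨⟨c, d⟩, j⟩, ⟨hc, hd⟩, h⟩
    simp only at ha hb hc hd
    cases i <;> cases j <;> simp [antiSwapEdge] at h <;> omega

theorem exists_gPath_of_primalCrossing {ω : Config} (h : ω ∈ primalCrossing) (k : ℤ) :
    ∃ s t : ℤ × ℤ, (k ≤ s.1 ∧ 0 ≤ s.2) ∧ (t.1 ≤ 0 ∧ t.2 ≤ -k) ∧ ReflTransGen (gStep ω) s t := by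
  obtain ⟨s, hs, hs'⟩ := h.1 k
  obtain ⟨t, ht, ht'⟩ := h.2 k
  refine ⟨s, (-t.2, -t.1), ⟨hs, (mem_NEquad_of_reflTransGen hs').2⟩,
    ⟨neg_nonpos.2 (mem_NEquad_of_reflTransGen ht').2, neg_le_neg ht⟩, ?_⟩
  have h1 : ReflTransGen (gStep ω) s (0, 0) := by
    rw [← reflTransGen_swap]
    refine ReflTransGen.mono ?_ _ _ hs'
    intro u v huv
    have := huv.1
    rw [gStep_iff] at this
    simp only [Bool.not_eq_true', Bool.not_eq_false'] at this
    change gStep ω v u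
    rw [gStep_iff]
    tauto
  have h2 : ReflTransGen (gStep ω) (0, 0) (-t.2, -t.1) := by
    refine ReflTransGen.lift (fun v : ℤ × ℤ => (-v.2, -v.1)) ?_ (0, 0) t ht'
    rintro ⟨a, b⟩ ⟨c, d⟩ ⟨huv, -, -⟩
    rw [Function.onFun, gStep_iff]
    rw [gStep_iff] at huv
    simp only [Prod.mk.injEq, antiSwapEdge, Bool.not_eq_true', Bool.not_eq_false',
      if_true, Bool.false_eq_true, if_false] at huv ⊢
    rcases huv with ⟨⟨rfl, rfl⟩, hω⟩ | ⟨⟨rfl, rfl⟩, hω⟩ | ⟨⟨rfl, rfl⟩, hω⟩ | ⟨⟨rfl, rfl⟩, hω⟩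
    · exact Or.inr (Or.inr (Or.inr ⟨by omega, by rwa [neg_add']⟩))
    · exact Or.inr (Or.inr (Or.inl ⟨by omega, by rwa [neg_add']⟩))
    · exact Or.inr (Or.inl ⟨by omega, by rwa [neg_add']⟩)
    · exact Or.inl ⟨by omega, by rwa [neg_add']⟩
  exact h1.trans h2

theorem exists_dualPath_to_west {ω : Config} {k : ℕ}
    (h : (fun e => ω (shiftEdge k (dualNW e))) ∈ reachesEast) (M : ℤ) :
    ∃ b : ℤ × ℤ, b.1 ≤ -M ∧ ReflTransGen (fun d d' => dualStep ω d d' ∧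
      d ∈ antiQuads (k, -k - 1) ∧ d' ∈ antiQuads (k, -k - 1)) (k, -k - 1) b := by
  obtain ⟨v, hv, hv'⟩ := h (M + k)
  refine ⟨(-v.1 + k, v.2 - k - 1), by simp only; omega, ?_⟩
  have hlift := ReflTransGen.lift (p := fun d d' => dualStep ω d d' ∧
    d ∈ antiQuads (k, -k - 1) ∧ d' ∈ antiQuads (k, -k - 1))
    (fun v : ℤ × ℤ => (-v.1 + (k : ℤ), v.2 - k - 1)) ?_ _ _ hv'
  · simpa [Function.onFun] using hlift
  rintro ⟨a, b⟩ ⟨c, d⟩ ⟨huv, hu, hv⟩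
  refine ⟨?_, ?_, ?_⟩
  · rw [gStep_iff] at huv
    simp only [Prod.mk.injEq, dualNW, shiftEdge, if_true, Bool.false_eq_true, if_false] at huv
    simp only [dualStep, Prod.mk.injEq]
    rcases huv with ⟨⟨rfl, rfl⟩, hω⟩ | ⟨⟨rfl, rfl⟩, hω⟩ | ⟨⟨rfl, rfl⟩, hω⟩ | ⟨⟨rfl, rfl⟩, hω⟩
    · exact Or.inr (Or.inl ⟨by omega, by convert hω using 4; omega⟩)
    · exact Or.inr (Or.inr (Or.inl ⟨by omega, by convert hω using 4; omega⟩))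
    · exact Or.inl ⟨by omega, by convert hω using 4; omega⟩
    · exact Or.inr (Or.inr (Or.inr ⟨by omega, by convert hω using 4; omega⟩))
  · simp only [NEquad, antiQuads, Set.mem_ofPred_eq] at hu ⊢
    omega
  · simp only [NEquad, antiQuads, Set.mem_ofPred_eq] at hv ⊢
    omega

theorem exists_dualPath_from_east {ω : Config} {k : ℕ}
    (h : (fun e => ω (shiftEdge k (dualSE e))) ∈ reachesEast) (M : ℤ) :
    ∃ a : ℤ × ℤ, M ≤ a.1 ∧ ReflTransGen (fun d d' => dualStep ω d d' ∧
      d ∈ antiQuads (k, -k - 1) ∧ d' ∈ antiQuads (k, -k - 1)) a (k, -k - 1) := by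
  obtain ⟨v, hv, hv'⟩ := h M
  refine ⟨(v.1 + k, -v.2 - k - 1), by simp only; omega, ?_⟩
  rw [← reflTransGen_swap]
  have hlift := ReflTransGen.lift (p := Function.swap fun d d' => dualStep ω d d' ∧
    d ∈ antiQuads (k, -k - 1) ∧ d' ∈ antiQuads (k, -k - 1))
    (fun v : ℤ × ℤ => (v.1 + (k : ℤ), -v.2 - k - 1)) ?_ _ _ hv'
  · simpa [Function.onFun] using hlift
  rintro ⟨a, b⟩ ⟨c, d⟩ ⟨huv, hu, hv⟩
  refine ⟨?_, ?_, ?_⟩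
  · rw [gStep_iff] at huv
    simp only [Prod.mk.injEq, dualSE, shiftEdge, if_true, Bool.false_eq_true, if_false] at huv
    simp only [dualStep, Prod.mk.injEq]
    rcases huv with ⟨⟨rfl, rfl⟩, hω⟩ | ⟨⟨rfl, rfl⟩, hω⟩ | ⟨⟨rfl, rfl⟩, hω⟩ | ⟨⟨rfl, rfl⟩, hω⟩
    · exact Or.inr (Or.inl ⟨by omega, by convert hω using 4; omega⟩)
    · exact Or.inr (Or.inr (Or.inl ⟨by omega, by convert hω using 4; omega⟩))
    · exact Or.inl ⟨by omega, by convert hω using 4; omega⟩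
    · exact Or.inr (Or.inr (Or.inr ⟨by omega, by convert hω using 4; omega⟩))
  · simp only [NEquad, antiQuads, Set.mem_ofPred_eq] at hv ⊢
    omega
  · simp only [NEquad, antiQuads, Set.mem_ofPred_eq] at hu ⊢
    omega

theorem primalCrossing_inter_shift_dualCrossing (k : ℕ) :
    primalCrossing ∩ {ω | (fun e => ω (shiftEdge k e)) ∈ dualCrossing} = ∅ := by
  refine Set.eq_empty_of_forall_notMem fun ω ⟨hP, hD⟩ => ?_
  obtain ⟨s, t, hs, ht, hst⟩ := exists_gPath_of_primalCrossing hP (k + 1)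
  refine not_reflTransGen_of_dual (c := (k, -k - 1)) (exists_dualPath_from_east hD.2)
    (exists_dualPath_to_west hD.1) ?_ ?_ hst
  · constructor <;> simp only <;> omega
  · constructor <;> simp only <;> omega

/-- If `θ_NE(1 - p) > 0` then `θ_NE(p) = 0`; in particular the NE-quadrant model
cannot percolate for both parameters `p` and `1 - p`. -/
theorem thetaNE_eq_zero_of_thetaNE_one_sub_pos (p : ℝ) (hp0 : 0 ≤ p) (hp1 : p ≤ 1)
    (h : 0 < thetaNE (1 - p)) : thetaNE p = 0 := by
  lift p to unitInterval using ⟨hp0, hp1⟩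
  by_contra h0
  rw [← unitInterval.coe_symm_eq] at h
  have hp := law_reachesEast_ne_zero p h0
  have hq := law_reachesEast_ne_zero _ h.ne'
  obtain ⟨k, hk⟩ := exists_measure_inter_preimage_ne_zero (coin p) shiftEdge_injective
    exists_shiftEdge_notMem measurableSet_primalCrossing measurableSet_dualCrossing
    (by rw [law_primalCrossing]; exact mul_ne_zero hq hq)
    (by rw [law_dualCrossing]; exact mul_ne_zero hp hp)
  exact hk (by rw [primalCrossing_inter_shift_dualCrossing, measure_empty])

end RandomOrientation
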